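/- arXiv:2112.11082 — 9 statements merged into one kernel-verified Lean document; each statement's English description precedes it below -/
import Mathlib

section
/- Let G be a group acting on a topological space X by homeomorphisms and let R be a locally finite fundamental region for the action. Then the continuous bijection κ : closure(R)/G → X/G induced by the inclusion closure(R) → X is a homeomorphism, where closure(R)/G is the quotient of closure(R) by the restriction of the orbit equivalence relation and X/G is the orbit space with the quotient topology. -/
open Pointwise

/-- An open set `R ⊆ X` is a *fundamental region* for the action of `G` on `X` if the
translates `{g • R}` are pairwise disjoint and the translated closures `{g • closure R}`
cover `X`. -/
def IsFundamentalRegion (G : Type*) [Group G] {X : Type*} [TopologicalSpace X] [MulAction G X]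
    (R : Set X) : Prop :=
  IsOpen R ∧ (Pairwise fun g h : G => Disjoint (g • R) (h • R)) ∧
    (⋃ g : G, g • closure R) = Set.univ

/-- If the fundamental region `R` is locally finite, then the continuous bijection
`κ : closure R / G → X / G` induced by the inclusion `closure R → X` is a homeomorphism. -/
theorem isHomeomorph_of_locallyFinite (G X : Type*) [Group G]
    [TopologicalSpace X] [MulAction G X] [ContinuousConstSMul G X]
    (R : Set X) (hR : IsFundamentalRegion G R)
    (hLF : LocallyFinite fun g : G => g • closure R)
    (κ : Quotient (Setoid.comap (Subtype.val : closure R → X) (MulAction.orbitRel G X)) →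
        Quotient (MulAction.orbitRel G X))
    (hκ : ∀ x : closure R,
      κ (Quotient.mk (Setoid.comap Subtype.val (MulAction.orbitRel G X)) x) =
        Quotient.mk (MulAction.orbitRel G X) (x : X)) :
    IsHomeomorph κ := by
  rw [isHomeomorph_iff_continuous_isClosedMap_bijective]
  obtain ⟨-, -, hcov⟩ := hR
  refine ⟨?_, ?_, ?_, ?_⟩
  · have hq : Topology.IsQuotientMap
        (Quotient.mk (Setoid.comap (Subtype.val : closure R → X) (MulAction.orbitRel G X))) :=
      isQuotientMap_quotient_mk'
    rw [hq.continuous_iff]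
    have h : κ ∘ Quotient.mk (Setoid.comap (Subtype.val : closure R → X)
        (MulAction.orbitRel G X)) = fun x : closure R => Quotient.mk (MulAction.orbitRel G X) (x : X) :=
      funext hκ
    rw [h]
    exact continuous_quot_mk.comp continuous_subtype_val
  · intro C hC
    have hq : Topology.IsQuotientMap (Quotient.mk (MulAction.orbitRel G X)) :=
      isQuotientMap_quotient_mk'
    rw [← hq.isClosed_preimage]
    have hD : IsClosed ((Subtype.val : closure R → X) ''
        (Quotient.mk (Setoid.comap Subtype.val (MulAction.orbitRel G X)) ⁻¹' C)) :=
      isClosed_closure.isClosedMap_subtype_val _ (hC.preimage continuous_quot_mk)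
    set D := (Subtype.val : closure R → X) ''
        (Quotient.mk (Setoid.comap Subtype.val (MulAction.orbitRel G X)) ⁻¹' C) with hDdef
    have hDR : D ⊆ closure R := by
      rintro _ ⟨y, -, rfl⟩
      exact y.2
    have key : Quotient.mk (MulAction.orbitRel G X) ⁻¹' (κ '' C) = ⋃ g : G, g • D := by
      ext x
      simp only [Set.mem_preimage, Set.mem_image, Set.mem_iUnion]
      constructor
      · rintro ⟨c, hc, hcx⟩
        induction c using Quotient.inductionOn with
        | h y =>
          rw [hκ] at hcx
          obtain ⟨g, hg⟩ := Quotient.exact hcx.symm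
          exact ⟨g, Set.mem_smul_set.2 ⟨y, ⟨y, hc, rfl⟩, hg⟩⟩
      · rintro ⟨g, hg⟩
        obtain ⟨_, ⟨y, hy, rfl⟩, rfl⟩ := Set.mem_smul_set.1 hg
        refine ⟨_, hy, ?_⟩
        rw [hκ]
        exact (Quotient.sound (s := MulAction.orbitRel G X) ⟨g, rfl⟩).symm
    rw [key]
    exact (hLF.subset fun g => Set.smul_set_mono hDR).isClosed_iUnion fun g => hD.smul g
  · intro a b
    induction a using Quotient.inductionOn with
    | h a =>
      induction b using Quotient.inductionOn with
      | h b =>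
        rw [hκ, hκ]
        intro h
        have h' : (MulAction.orbitRel G X) (a : X) (b : X) := Quotient.exact h
        exact Quotient.sound (s := Setoid.comap Subtype.val (MulAction.orbitRel G X))
          h'
  · intro b
    induction b using Quotient.inductionOn with
    | h x =>
      have hx : x ∈ ⋃ g : G, g • closure R := hcov ▸ Set.mem_univ x
      obtain ⟨g, hg⟩ := Set.mem_iUnion.1 hx
      obtain ⟨y, hy, rfl⟩ := Set.mem_smul_set.1 hg
      refine ⟨Quotient.mk _ ⟨y, hy⟩, ?_⟩
      rw [hκ]
      exact (Quotient.sound (s := MulAction.orbitRel G X) ⟨g, rfl⟩).symm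
end

section
/- Let G be a group acting on a first-countable topological space X by homeomorphisms, with the action properly discontinuous, and let R be a fundamental region for the action. If the continuous bijection κ : closure(R)/G → X/G induced by the inclusion closure(R) → X is a homeomorphism (where closure(R)/G is the quotient of closure(R) by the restriction of the orbit equivalence relation and X/G is the orbit space with the quotient topology), then R is locally finite. -/
open Pointwise

/-- The action of `G` on `X` is *properly discontinuous* if (i) every point has a
neighbourhood `U` such that `g • U` meets `U` only for `g = 1`, and (ii) any two points in
different orbits have neighbourhoods `U`, `V` such that `g • U` never meets `V`. -/
def ProperlyDiscontinuousAction (G : Type*) [Group G] (X : Type*) [TopologicalSpace X]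
    [MulAction G X] : Prop :=
  (∀ x : X, ∃ U : Set X, IsOpen U ∧ x ∈ U ∧ ∀ g : G, ((g • U) ∩ U).Nonempty → g = 1) ∧
  (∀ x y : X, y ∉ MulAction.orbit G x →
    ∃ U V : Set X, IsOpen U ∧ x ∈ U ∧ IsOpen V ∧ y ∈ V ∧ ∀ g : G, Disjoint (g • U) V)

/-- If `X` is first countable, the action is properly discontinuous, and the continuous
bijection `κ : closure R / G → X / G` induced by the inclusion is a homeomorphism, then the
fundamental region `R` is locally finite. -/
theorem locallyFinite_of_isHomeomorph (G X : Type*) [Group G]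
    [TopologicalSpace X] [FirstCountableTopology X] [MulAction G X] [ContinuousConstSMul G X]
    (hPD : ProperlyDiscontinuousAction G X)
    (R : Set X) (hR : IsFundamentalRegion G R)
    (κ : Quotient (Setoid.comap (Subtype.val : closure R → X) (MulAction.orbitRel G X)) →
        Quotient (MulAction.orbitRel G X))
    (hκ : ∀ x : closure R,
      κ (Quotient.mk (Setoid.comap Subtype.val (MulAction.orbitRel G X)) x) =
        Quotient.mk (MulAction.orbitRel G X) (x : X))
    (hHomeo : IsHomeomorph κ) :
    LocallyFinite fun g : G => g • closure R := by
  classical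
  obtain ⟨hO, hdisj, -⟩ := hR
  obtain ⟨hP1, hP2⟩ := hPD
  -- points are closed
  have hT1 : ∀ x : X, IsClosed ({x} : Set X) := by
    intro x
    rw [← isOpen_compl_iff, isOpen_iff_forall_mem_open]
    intro y hy
    by_cases h : y ∈ MulAction.orbit G x
    · obtain ⟨U, hUo, hyU, hU⟩ := hP1 y
      refine ⟨U, ?_, hUo, hyU⟩
      rintro z hz rfl
      obtain ⟨g, rfl⟩ := h
      have : g = 1 := hU g ⟨g • z, Set.smul_mem_smul_set hz, hyU⟩
      subst this
      simp at hy
    · obtain ⟨U, V, -, hxU, hVo, hyV, hUV⟩ := hP2 x y h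
      refine ⟨V, ?_, hVo, hyV⟩
      rintro z hz rfl
      have := hUV 1
      rw [one_smul] at this
      exact Set.disjoint_left.1 this hxU hz
  by_contra hlf
  obtain ⟨y, hy⟩ : ∃ y : X, ∀ t ∈ nhds y, {g : G | ((g • closure R) ∩ t).Nonempty}.Infinite := by
    simp only [LocallyFinite] at hlf
    push Not at hlf
    exact hlf
  obtain ⟨B, hB⟩ := (nhds y).exists_antitone_basis
  have hy' : ∀ n, {g : G | ((g • R) ∩ B n).Nonempty}.Infinite := by
    intro n
    refine (hy (interior (B n)) (interior_mem_nhds.2 (hB.mem n))).mono ?_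
    intro g hg
    have hg' : (closure (g • R) ∩ interior (B n)).Nonempty := by
      rw [closure_smul]; exact hg
    obtain ⟨z, hz, hzB⟩ := hg'
    obtain ⟨w, hw, hw'⟩ := mem_closure_iff.1 hz _ isOpen_interior hzB
    exact ⟨w, hw', interior_subset hw⟩
  obtain ⟨f, hf, hfr⟩ := exists_seq_of_forall_finset_exists
    (fun p : ℕ × G => ((p.2 • R) ∩ B p.1).Nonempty) (fun p q => p.1 < q.1 ∧ p.2 ≠ q.2) (by
      intro s _
      obtain ⟨g, hg, hgs⟩ := (hy' (s.sup Prod.fst + 1)).exists_notMem_finset (s.image Prod.snd)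
      refine ⟨(s.sup Prod.fst + 1, g), hg, ?_⟩
      intro p hp
      refine ⟨Nat.lt_succ_of_le (Finset.le_sup (f := Prod.fst) hp), ?_⟩
      rintro rfl
      exact hgs (Finset.mem_image_of_mem _ hp))
  have hmono : StrictMono fun n => (f n).1 := fun m n h => (hfr m n h).1
  have hinj : ∀ m n, (f m).2 = (f n).2 → m = n := by
    intro m n h
    rcases lt_trichotomy m n with h' | h' | h'
    · exact absurd h (hfr m n h').2
    · exact h'
    · exact absurd h.symm (hfr n m h').2
  have hx : ∀ n, ∃ x ∈ R, (f n).2 • x ∈ B n := by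
    intro n
    obtain ⟨z, ⟨x, hx, rfl⟩, hz⟩ := hf n
    exact ⟨x, hx, hB.antitone (hmono.id_le n) hz⟩
  choose x hxR hxB using hx
  have htend : Filter.Tendsto (fun n => (f n).2 • x n) Filter.atTop (nhds y) := hB.tendsto hxB
  -- `y` lies in no translate of `R`
  have hyR : ∀ h : G, y ∉ h • R := by
    intro h hyh
    have hev := htend.eventually ((hO.smul h).mem_nhds hyh)
    obtain ⟨N, hN⟩ := Filter.eventually_atTop.1 hev
    have key : ∀ n, N ≤ n → (f n).2 = h := by
      intro n hn
      by_contra hne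
      exact Set.disjoint_left.1 (hdisj hne) (Set.smul_mem_smul_set (hxR n)) (hN n hn)
    have := hinj N (N + 1) ((key N le_rfl).trans (key (N + 1) (by omega)).symm)
    omega
  -- the sequence has no accumulation point
  have hKlf : LocallyFinite fun n => ({x n} : Set X) := by
    intro z
    by_cases hz : y ∈ MulAction.orbit G z
    · obtain ⟨h, rfl⟩ := hz
      obtain ⟨U, hUo, hyU, hU⟩ := hP1 (h • z)
      obtain ⟨N, hN⟩ := Filter.eventually_atTop.1 (htend.eventually (hUo.mem_nhds hyU))
      refine ⟨h⁻¹ • U, (hUo.smul _).mem_nhds ?_, ?_⟩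
      · rw [Set.mem_inv_smul_set_iff]; exact hyU
      · have hsub : {n | (f n).2 = h}.Finite :=
          Set.Subsingleton.finite fun m hm n hn => hinj m n (hm.trans hn.symm)
        refine ((Set.finite_lt_nat N).union hsub).subset ?_
        rintro n ⟨w, rfl, hw⟩
        rcases lt_or_ge n N with hn | hn
        · exact Or.inl hn
        · right
          rw [Set.mem_inv_smul_set_iff] at hw
          have : (f n).2 * h⁻¹ = 1 := by
            refine hU _ ⟨(f n).2 • x n, ?_, hN n hn⟩
            refine ⟨h • x n, hw, ?_⟩
            simp [mul_smul]
          exact mul_inv_eq_one.1 this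
    · obtain ⟨U, V, hUo, hzU, hVo, hyV, hUV⟩ := hP2 z y hz
      obtain ⟨N, hN⟩ := Filter.eventually_atTop.1 (htend.eventually (hVo.mem_nhds hyV))
      refine ⟨U, hUo.mem_nhds hzU, (Set.finite_lt_nat N).subset ?_⟩
      rintro n ⟨w, rfl, hw⟩
      by_contra hn
      exact Set.disjoint_left.1 (hUV (f n).2) (Set.smul_mem_smul_set hw)
        (hN n (not_lt.1 hn))
  have hKc : IsClosed (⋃ n, ({x n} : Set X)) := hKlf.isClosed_iUnion fun n => hT1 _
  let T : Set (Quotient (MulAction.orbitRel G X)) :=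
    Set.range fun n => Quotient.mk (MulAction.orbitRel G X) (x n)
  have hAc : IsClosed (κ ⁻¹' T) := by
    rw [← (isQuotientMap_quotient_mk'
      (s := Setoid.comap (Subtype.val : closure R → X) (MulAction.orbitRel G X))).isClosed_preimage]
    convert hKc.preimage (continuous_subtype_val (p := fun z => z ∈ closure R)) using 1
    ext ⟨w, hw⟩
    simp only [Set.mem_preimage, Set.mem_iUnion, Set.mem_singleton_iff]
    constructor
    · rintro ⟨n, hn⟩
      refine ⟨n, ?_⟩
      have hn' := hn.trans (hκ ⟨w, hw⟩)
      obtain ⟨g, hg⟩ := Quotient.exact hn'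
      have hg : g • w = x n := hg
      have hw2 : g • w ∈ closure (g • R) := by
        rw [closure_smul]; exact Set.smul_mem_smul_set hw
      obtain ⟨v, hv, hv'⟩ := mem_closure_iff.1 hw2 R hO (hg ▸ hxR n)
      have hg1 : g = 1 := by
        by_contra hne
        have := hdisj hne
        simp only [one_smul] at this
        exact Set.disjoint_left.1 this hv' hv
      rw [← hg, hg1, one_smul]
    · rintro ⟨n, hn⟩
      exact ⟨n, by subst hn; exact (hκ ⟨x n, hw⟩).symm⟩
  have hTc : IsClosed T := by
    have := hHomeo.isClosedMap _ hAc
    rwa [Set.image_preimage_eq _ hHomeo.bijective.surjective] at this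
  have hpc : IsClosed ((Quotient.mk (MulAction.orbitRel G X)) ⁻¹' T) :=
    hTc.preimage continuous_quotient_mk'
  have hyT := hpc.mem_of_tendsto htend (Filter.Eventually.of_forall fun n =>
    (⟨n, Quotient.sound (s := MulAction.orbitRel G X) (by
      refine ⟨(f n).2⁻¹, ?_⟩
      simp)⟩ : Quotient.mk (MulAction.orbitRel G X) ((f n).2 • x n) ∈ T))
  obtain ⟨n, hn⟩ := hyT
  obtain ⟨g, hg⟩ := Quotient.exact hn
  have hg : g • y = x n := hg
  apply hyR g⁻¹
  rw [Set.mem_inv_smul_set_iff, hg]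
  exact hxR n
end

section
/- Let G be a group acting on a topological space X by homeomorphisms and let R be a fundamental region for the action. If R is finitely self adjacent, then R is locally finite. -/
open Pointwise

/-- A fundamental region `R` is *finitely self adjacent* if there is an open neighbourhood `U`
of `closure R` such that `g • U` meets `U` for only finitely many `g ∈ G`. -/
def FinitelySelfAdjacent (G : Type*) [Group G] {X : Type*} [TopologicalSpace X] [MulAction G X]
    (R : Set X) : Prop :=
  ∃ U : Set X, IsOpen U ∧ closure R ⊆ U ∧ {g : G | ((g • U) ∩ U).Nonempty}.Finite

/-- A finitely self adjacent fundamental region is locally finite. -/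
theorem locallyFinite_of_finitelySelfAdjacent (G X : Type*) [Group G]
    [TopologicalSpace X] [MulAction G X] [ContinuousConstSMul G X]
    (R : Set X) (hR : IsFundamentalRegion G R) (hFSA : FinitelySelfAdjacent G R) :
    LocallyFinite fun g : G => g • closure R := by
  obtain ⟨U, hU, hRU, hfin⟩ := hFSA
  intro x
  have hx : x ∈ ⋃ g : G, g • closure R := by rw [hR.2.2]; trivial
  obtain ⟨h, hxh⟩ := Set.mem_iUnion.1 hx
  refine ⟨h • U, (hU.smul h).mem_nhds (Set.smul_set_mono hRU hxh), ?_⟩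
  refine (hfin.image (fun k => h * k)).subset ?_
  rintro g ⟨y, hy1, hy2⟩
  refine ⟨h⁻¹ * g, ⟨h⁻¹ • y, ?_, ?_⟩, by simp⟩
  · rw [mul_smul]
    exact Set.smul_mem_smul_set (Set.smul_set_mono hRU hy1)
  · exact Set.mem_smul_set_iff_inv_smul_mem.1 hy2
end

section
/- Let G be a group acting on a topological space X by homeomorphisms, where singletons in X are closed (X is T1), let R be a finitely self adjacent fundamental region for the action, and let x be a boundary point of R. Then there is an open neighbourhood U of closure(R) such that U ∩ (G • x) = ∂R ∩ (G • x). -/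
open Pointwise

/-- If singletons of `X` are closed, `R` is a finitely self adjacent fundamental region and
`x` is a boundary point of `R`, then there is an open neighbourhood `U` of `closure R` with
`U ∩ G • x = frontier R ∩ G • x`. -/
theorem exists_nhd_inter_orbit_eq_frontier_inter_orbit (G X : Type*) [Group G]
    [TopologicalSpace X] [T1Space X] [MulAction G X] [ContinuousConstSMul G X]
    (R : Set X) (hR : IsFundamentalRegion G R) (hFSA : FinitelySelfAdjacent G R)
    (x : X) (hx : x ∈ frontier R) :
    ∃ U : Set X, IsOpen U ∧ closure R ⊆ U ∧
      U ∩ MulAction.orbit G x = frontier R ∩ MulAction.orbit G x := by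
  obtain ⟨hRo, hdisj, -⟩ := hR
  obtain ⟨V, hVo, hRV, hfin⟩ := hFSA
  have hxc : x ∈ closure R := frontier_subset_closure hx
  have hxV : x ∈ V := hRV hxc
  have hF : (V ∩ MulAction.orbit G x).Finite := by
    refine (hfin.image (fun g : G => g • x)).subset ?_
    rintro y ⟨hyV, g, rfl⟩
    exact ⟨g, ⟨g • x, Set.smul_mem_smul_set hxV, hyV⟩, rfl⟩
  have hxR : x ∉ R := by
    intro h
    rw [hRo.frontier_eq] at hx
    exact hx.2 h
  have hno : ∀ g : G, g • x ∉ R := by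
    intro g hg
    have hmem : x ∈ g⁻¹ • R := by
      rw [Set.mem_inv_smul_set_iff]
      exact hg
    obtain ⟨y, hy1, hy2⟩ := mem_closure_iff.1 hxc _ (hRo.smul g⁻¹) hmem
    by_cases h1 : g⁻¹ = 1
    · rw [h1, one_smul] at hmem
      exact hxR hmem
    · have hd : Disjoint (g⁻¹ • R) ((1 : G) • R) := hdisj h1
      rw [one_smul] at hd
      exact Set.disjoint_left.1 hd hy1 hy2
  refine ⟨V \ ((V ∩ MulAction.orbit G x) \ closure R),
    hVo.sdiff (hF.subset Set.diff_subset).isClosed, ?_, ?_⟩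
  · intro y hy
    exact ⟨hRV hy, fun h => h.2 hy⟩
  · ext y
    constructor
    · rintro ⟨⟨hyV, hy⟩, hyo⟩
      refine ⟨?_, hyo⟩
      rw [hRo.frontier_eq]
      refine ⟨by_contra fun h => hy ⟨⟨hyV, hyo⟩, h⟩, ?_⟩
      obtain ⟨g, rfl⟩ := hyo
      exact hno g
    · rintro ⟨hy, hyo⟩
      have hyc := frontier_subset_closure hy
      exact ⟨⟨hRV hyc, fun h => h.2 hyc⟩, hyo⟩
end

section
/- Let G be a group acting on a locally compact topological space X by homeomorphisms such that the orbit space X/G (with the quotient topology) is compact, and let R be a fundamental region for the action. If R is finitely self adjacent, then closure(R) is compact. -/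
open Pointwise

/-- If `X` is locally compact, the orbit space `X / G` is compact, and `R` is a finitely
self adjacent fundamental region, then `closure R` is compact. -/
theorem isCompact_closure_of_finitelySelfAdjacent (G X : Type*) [Group G]
    [TopologicalSpace X] [LocallyCompactSpace X] [MulAction G X] [ContinuousConstSMul G X]
    (hq : CompactSpace (Quotient (MulAction.orbitRel G X)))
    (R : Set X) (hR : IsFundamentalRegion G R) (hFSA : FinitelySelfAdjacent G R) :
    IsCompact (closure R) := by
  obtain ⟨-, -, hcov⟩ := hR
  obtain ⟨U, hUo, hRU, hfin⟩ := hFSA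
  let p : X → Quotient (MulAction.orbitRel G X) := Quotient.mk _
  have hp : IsOpenMap p := isOpenMap_quotient_mk'_mul
  have h1 : ∀ q : Quotient (MulAction.orbitRel G X),
      ∃ K : Set X, IsCompact K ∧ K ⊆ U ∧ p '' K ∈ nhds q := by
    intro q
    obtain ⟨x, rfl⟩ := Quotient.exists_rep q
    have hx : x ∈ ⋃ g : G, g • closure R := hcov ▸ Set.mem_univ x
    obtain ⟨g, y, hy, rfl⟩ := Set.mem_iUnion.1 hx
    obtain ⟨K, hK, hKU, hKc⟩ := local_compact_nhds (hUo.mem_nhds (hRU hy))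
    refine ⟨K, hKc, hKU, ?_⟩
    have hq' : (Quotient.mk (MulAction.orbitRel G X) (g • y)) = p y :=
      Quotient.sound (MulAction.mem_orbit y g)
    change p '' K ∈ nhds (Quotient.mk (MulAction.orbitRel G X) (g • y))
    rw [hq']
    exact hp.image_mem_nhds hK
  choose K hKc hKU hKn using h1
  obtain ⟨t, -, ht⟩ := isCompact_univ.elim_nhds_subcover (fun q => p '' K q) (fun q _ => hKn q)
  have hC : IsCompact (⋃ g ∈ {g : G | ((g • U) ∩ U).Nonempty}, g • (⋃ q ∈ t, K q)) :=
    hfin.isCompact_biUnion fun g _ => (t.isCompact_biUnion fun q _ => hKc q).smul g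
  refine hC.of_isClosed_subset isClosed_closure fun x hx => ?_
  obtain ⟨q, hq, y, hy, hyx⟩ := Set.mem_iUnion₂.1 (ht (Set.mem_univ (p x)))
  obtain ⟨g, rfl⟩ : x ∈ MulAction.orbit G y :=
    (Quotient.exact hyx.symm : (MulAction.orbitRel G X) x y)
  exact Set.mem_iUnion₂.2 ⟨g, ⟨g • y, Set.smul_mem_smul_set (hKU q hy), hRU hx⟩,
    Set.smul_mem_smul_set (Set.mem_iUnion₂.2 ⟨q, hq, hy⟩)⟩
end

section
/- Let G be a group acting on a first-countable topological space X by homeomorphisms, with the action properly discontinuous, and let R be a fundamental region for the action. If closure(R) is compact, then R is locally finite. -/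
open Pointwise

/-- If `X` is first countable, the action is properly discontinuous and the fundamental
region `R` has compact closure, then `R` is locally finite. -/
theorem locallyFinite_of_isCompact_closure (G X : Type*) [Group G]
    [TopologicalSpace X] [FirstCountableTopology X] [MulAction G X] [ContinuousConstSMul G X]
    (hPD : ProperlyDiscontinuousAction G X)
    (R : Set X) (hR : IsFundamentalRegion G R) (hc : IsCompact (closure R)) :
    LocallyFinite fun g : G => g • closure R := by
  intro x
  refine hc.induction_on (p := fun s => ∃ U ∈ nhds x, {g : G | ((g • s) ∩ U).Nonempty}.Finite)
    ?_ ?_ ?_ ?_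
  · exact ⟨Set.univ, Filter.univ_mem, by simp⟩
  · rintro s t hst ⟨U, hU, hf⟩
    refine ⟨U, hU, hf.subset ?_⟩
    intro g hg
    exact hg.mono (Set.inter_subset_inter_left _ (Set.smul_set_mono hst))
  · rintro s t ⟨U, hU, hf⟩ ⟨V, hV, hf'⟩
    refine ⟨U ∩ V, Filter.inter_mem hU hV, (hf.union hf').subset ?_⟩
    rintro g ⟨z, hz, hzU, hzV⟩
    rw [Set.smul_set_union] at hz
    rcases hz with hz | hz
    · exact Or.inl ⟨z, hz, hzU⟩
    · exact Or.inr ⟨z, hz, hzV⟩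
  · intro y _
    by_cases hy : y ∈ MulAction.orbit G x
    · obtain ⟨h, rfl⟩ := hy
      obtain ⟨W, hW, hxW, hWg⟩ := hPD.1 x
      refine ⟨h • W, mem_nhdsWithin_of_mem_nhds
        ((hW.smul h).mem_nhds (Set.smul_mem_smul_set hxW)), W, hW.mem_nhds hxW,
        (Set.finite_singleton h⁻¹).subset ?_⟩
      intro g hg
      have hg' : ((g • h • W) ∩ W).Nonempty := hg
      rw [smul_smul] at hg'
      exact eq_inv_of_mul_eq_one_left (hWg _ hg')
    · obtain ⟨U, V, hU, hxU, hV, hyV, hd⟩ := hPD.2 x y hy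
      refine ⟨V, mem_nhdsWithin_of_mem_nhds (hV.mem_nhds hyV), U, hU.mem_nhds hxU,
        Set.finite_empty.subset ?_⟩
      rintro g ⟨z, hzV, hzU⟩
      rw [Set.mem_smul_set_iff_inv_smul_mem] at hzV
      exact Set.disjoint_left.1 (hd g⁻¹) (Set.smul_mem_smul_set hzU) hzV
end

section
/- Let G be a group acting freely on a Hausdorff topological space X by homeomorphisms. If the action admits a finitely self adjacent fundamental region, then the action is properly discontinuous. -/
open Pointwise

theorem aux_separate {G X : Type*} [Group G]
    [TopologicalSpace X] [T2Space X] [MulAction G X] [ContinuousConstSMul G X]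
    {R : Set X} (hR : IsFundamentalRegion G R) (hF : FinitelySelfAdjacent G R) (x y : X) :
    ∃ A B : Set X, IsOpen A ∧ x ∈ A ∧ IsOpen B ∧ y ∈ B ∧
      ∀ g : G, ∀ p ∈ A, g • p ∈ B → g • x = y := by
  obtain ⟨-, -, hcov⟩ := hR
  obtain ⟨U, hU, hRU, hfin⟩ := hF
  have key : ∀ z : X, ∃ a : G, a⁻¹ • z ∈ U := by
    intro z
    have hz : z ∈ ⋃ g : G, g • closure R := hcov ▸ Set.mem_univ z
    obtain ⟨a, ha⟩ := Set.mem_iUnion.1 hz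
    exact ⟨a, hRU (Set.mem_smul_set_iff_inv_smul_mem.1 ha)⟩
  obtain ⟨a, ha⟩ := key x
  obtain ⟨b, hb⟩ := key y
  have h1 : ∀ᶠ p : X × X in nhds (x, y), a⁻¹ • p.1 ∈ U :=
    ContinuousAt.eventually_mem (f := fun p : X × X => a⁻¹ • p.1)
      (by fun_prop) (hU.mem_nhds ha)
  have h2 : ∀ᶠ p : X × X in nhds (x, y), b⁻¹ • p.2 ∈ U :=
    ContinuousAt.eventually_mem (f := fun p : X × X => b⁻¹ • p.2)
      (by fun_prop) (hU.mem_nhds hb)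
  have h3 : ∀ᶠ p : X × X in nhds (x, y), ∀ f ∈ {g : G | ((g • U) ∩ U).Nonempty},
      (b * f * a⁻¹) • p.1 = p.2 → (b * f * a⁻¹) • x = y := by
    rw [Filter.eventually_all_finite hfin]
    intro f _
    by_cases h : (b * f * a⁻¹) • x = y
    · exact Filter.Eventually.of_forall fun _ _ => h
    · have hc : IsOpen {p : X × X | (b * f * a⁻¹) • p.1 ≠ p.2} :=
        isOpen_ne_fun (by fun_prop) (by fun_prop)
      filter_upwards [hc.mem_nhds h] with p hp hp'
      exact absurd hp' hp
  obtain ⟨A, B, hA, hxA, hB, hyB, hAB⟩ := mem_nhds_prod_iff'.1 (h1.and (h2.and h3))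
  refine ⟨A, B, hA, hxA, hB, hyB, fun g p hp hgp => ?_⟩
  obtain ⟨k1, k2, k3⟩ := hAB (Set.mk_mem_prod hp hgp)
  have e : b * (b⁻¹ * g * a) * a⁻¹ = g := by group
  have := k3 (b⁻¹ * g * a) ⟨b⁻¹ • g • p,
    Set.mem_smul_set.2 ⟨a⁻¹ • p, k1, by simp [mul_smul]⟩, k2⟩
  rw [e] at this
  exact this rfl

/-- If a group `G` acts freely on a Hausdorff space `X` by homeomorphisms and the action
admits a finitely self adjacent fundamental region, then the action is properly
discontinuous. -/
theorem properlyDiscontinuous_of_finitelySelfAdjacent (G X : Type*) [Group G]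
    [TopologicalSpace X] [T2Space X] [MulAction G X] [ContinuousConstSMul G X]
    (hfree : ∀ (g : G) (x : X), g • x = x → g = 1)
    (hex : ∃ R : Set X, IsFundamentalRegion G R ∧ FinitelySelfAdjacent G R) :
    ProperlyDiscontinuousAction G X := by
  obtain ⟨R, hR, hF⟩ := hex
  constructor
  · intro x
    obtain ⟨A, B, hA, hxA, hB, hxB, h⟩ := aux_separate hR hF x x
    refine ⟨A ∩ B, hA.inter hB, ⟨hxA, hxB⟩, ?_⟩
    rintro g ⟨_, ⟨p, hp, rfl⟩, hq⟩
    exact hfree g x (h g p hp.1 hq.2)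
  · intro x y hxy
    obtain ⟨A, B, hA, hxA, hB, hyB, h⟩ := aux_separate hR hF x y
    refine ⟨A, B, hA, hxA, hB, hyB, fun g => Set.disjoint_left.2 ?_⟩
    rintro _ ⟨p, hp, rfl⟩ hq
    exact hxy ⟨g, h g p hp hq⟩
end

section
/- Let X be a topological space, let c ∈ ℝ with c > 0, and let φ be a homeomorphism of X × ℝ (with the product topology) such that the second coordinate of φ(x,t) equals t + c for all (x,t) ∈ X × ℝ. Then the set X × (0,c) is a finitely self adjacent fundamental region for the action of the cyclic group ⟨φ⟩ generated by φ (acting by the iterates φ^m, m ∈ ℤ). -/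
open Pointwise

theorem zpow_snd_aux {X : Type*} (c : ℝ) (e : Equiv.Perm (X × ℝ))
    (h : ∀ p : X × ℝ, (e p).2 = p.2 + c) (n : ℤ) (p : X × ℝ) :
    ((e ^ n) p).2 = p.2 + n * c := by
  induction n using Int.induction_on generalizing p with
  | zero => simp
  | succ k ih =>
    rw [zpow_add_one, Equiv.Perm.mul_apply, ih, h]
    push_cast
    ring
  | pred k ih =>
    have h1 := h (e⁻¹ p)
    rw [← Equiv.Perm.mul_apply, mul_inv_cancel, Equiv.Perm.one_apply] at h1
    rw [zpow_sub_one, Equiv.Perm.mul_apply, ih]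
    push_cast at *
    linarith

/-- If `φ` is a homeomorphism of `X × ℝ` translating the second coordinate by `c > 0`, then
`X × (0, c)` is a finitely self adjacent fundamental region for the action of the cyclic
group `⟨φ⟩` generated by `φ` (acting by the iterates `φ^m`, `m ∈ ℤ`). -/
theorem isFundamentalRegion_prod_Ioo (X : Type*) [TopologicalSpace X]
    (c : ℝ) (hc : 0 < c) (φ : (X × ℝ) ≃ₜ (X × ℝ))
    (hφ : ∀ p : X × ℝ, (φ p).2 = p.2 + c) :
    IsFundamentalRegion (Subgroup.zpowers φ.toEquiv)
        ((Set.univ : Set X) ×ˢ Set.Ioo (0 : ℝ) c) ∧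
      FinitelySelfAdjacent (Subgroup.zpowers φ.toEquiv)
        ((Set.univ : Set X) ×ˢ Set.Ioo (0 : ℝ) c) := by
  have key := zpow_snd_aux c φ.toEquiv hφ
  have hcl : closure ((Set.univ : Set X) ×ˢ Set.Ioo (0 : ℝ) c)
      = (Set.univ : Set X) ×ˢ Set.Icc (0 : ℝ) c := by
    rw [closure_prod_eq, closure_univ, closure_Ioo hc.ne]
  refine ⟨⟨isOpen_univ.prod isOpen_Ioo, ?_, ?_⟩, ?_⟩
  · rintro ⟨_, m, rfl⟩ ⟨_, n, rfl⟩ hne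
    rw [Set.disjoint_left]
    rintro q ⟨r, ⟨-, hr0, hr1⟩, hr⟩ ⟨s, ⟨-, hs0, hs1⟩, hs⟩
    apply hne
    have e1 : r.2 + m * c = q.2 := by rw [← key m r, ← hr]; rfl
    have e2 : s.2 + n * c = q.2 := by rw [← key n s, ← hs]; rfl
    have h1 : m < n + 1 := by
      have : (m : ℝ) < n + 1 := by
        by_contra hcon
        push Not at hcon
        nlinarith
      exact_mod_cast this
    have h2 : n < m + 1 := by
      have : (n : ℝ) < m + 1 := by
        by_contra hcon
        push Not at hcon
        nlinarith
      exact_mod_cast this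
    have h3 : m = n := by omega
    subst h3
    rfl
  · rw [hcl, Set.eq_univ_iff_forall]
    intro q
    rw [Set.mem_iUnion]
    set n : ℤ := ⌊q.2 / c⌋ with hn
    refine ⟨⟨φ.toEquiv ^ n, n, rfl⟩, (φ.toEquiv ^ (-n)) q, ⟨Set.mem_univ _, ?_⟩, ?_⟩
    · have h1 : (n : ℝ) ≤ q.2 / c := Int.floor_le _
      have h2 : q.2 / c < n + 1 := Int.lt_floor_add_one _
      rw [le_div_iff₀ hc] at h1
      rw [div_lt_iff₀ hc] at h2
      rw [key]
      push_cast
      constructor <;> nlinarith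
    · change (φ.toEquiv ^ n) ((φ.toEquiv ^ (-n)) q) = q
      rw [← Equiv.Perm.mul_apply, ← zpow_add]
      simp
  · refine ⟨(Set.univ : Set X) ×ˢ Set.Ioo (-c) (2 * c), isOpen_univ.prod isOpen_Ioo, ?_, ?_⟩
    · rw [hcl]
      rintro p ⟨-, h0, h1⟩
      exact ⟨Set.mem_univ _, by linarith, by linarith⟩
    · refine ((Set.finite_Icc (-3 : ℤ) 3).image
        (fun n : ℤ => (⟨φ.toEquiv ^ n, n, rfl⟩ : Subgroup.zpowers φ.toEquiv))).subset ?_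
      rintro ⟨_, n, rfl⟩ ⟨q, ⟨r, ⟨-, hr0, hr1⟩, hr⟩, ⟨-, hq0, hq1⟩⟩
      have e1 : r.2 + n * c = q.2 := by rw [← key n r, ← hr]; rfl
      refine ⟨n, ⟨?_, ?_⟩, rfl⟩
      · have : (-3 : ℝ) ≤ n := by
          by_contra hcon
          push Not at hcon
          nlinarith
        exact_mod_cast this
      · have : (n : ℝ) ≤ 3 := by
          by_contra hcon
          push Not at hcon
          nlinarith
        exact_mod_cast this
end

section
/- Consider the action of ℤ on ℝ by translations, n • x = x + n. The set R = ⋃_{n ∈ ℕ} (n + n/(n+1), n + (n+1)/(n+2)) is a fundamental region for this action (its integer translates are pairwise disjoint and the integer translates of its closure cover ℝ), but the closure of R in ℝ is not compact. -/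
/-- Basic inequalities for a point of the `n`-th interval. -/
lemma aux_mem {n : ℕ} {x : ℝ}
    (h : x ∈ Set.Ioo ((n : ℝ) + n / (n + 1)) ((n : ℝ) + (n + 1) / (n + 2))) :
    (n : ℝ) ≤ x ∧ x < n + 1 ∧ (1 - (x - n)) * (n + 1) < 1 ∧ 1 < (1 - (x - n)) * (n + 2) := by
  obtain ⟨h1, h2⟩ := h
  have hn : (0 : ℝ) ≤ n := Nat.cast_nonneg n
  have a1 : (n : ℝ) / (n + 1) < x - n := by linarith
  have a2 : x - n < ((n : ℝ) + 1) / (n + 2) := by linarith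
  have a3 : (0 : ℝ) ≤ (n : ℝ) / (n + 1) := by positivity
  rw [div_lt_iff₀ (by positivity)] at a1
  have a4 : ((n : ℝ) + 1) / (n + 2) < 1 := by
    rw [div_lt_one (by positivity)]; linarith
  rw [lt_div_iff₀ (by positivity)] at a2
  refine ⟨by linarith, by linarith, by linarith, by linarith⟩

lemma aux_le {n l : ℕ} {u : ℝ} (hu : u < 1) (h1 : 1 < (1 - u) * ((n : ℝ) + 2))
    (h2 : (1 - u) * ((l : ℝ) + 1) < 1) : l ≤ n := by
  by_contra hc
  have : (n : ℝ) + 1 ≤ l := by exact_mod_cast (not_le.mp hc)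
  nlinarith

lemma aux_lt (n : ℕ) : (n : ℝ) + n / (n + 1) < (n : ℝ) + (n + 1) / (n + 2) := by
  have hn : (0 : ℝ) ≤ n := Nat.cast_nonneg n
  have : (n : ℝ) / (n + 1) < (n + 1) / (n + 2) := by
    rw [div_lt_div_iff₀ (by positivity) (by positivity)]; nlinarith
  linarith

/-- The set `R = ⋃ₙ (n + n/(n+1), n + (n+1)/(n+2))` is a fundamental region for the action
of `ℤ` on `ℝ` by translations `n • x = x + n` (its integer translates are pairwise disjoint
and the integer translates of its closure cover `ℝ`), but its closure is not compact. -/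
theorem fundamentalRegion_not_compact_example :
    IsOpen (⋃ n : ℕ, Set.Ioo ((n : ℝ) + n / (n + 1)) ((n : ℝ) + (n + 1) / (n + 2))) ∧
    (Pairwise fun m k : ℤ =>
      Disjoint
        ((fun x : ℝ => x + m) ''
          ⋃ n : ℕ, Set.Ioo ((n : ℝ) + n / (n + 1)) ((n : ℝ) + (n + 1) / (n + 2)))
        ((fun x : ℝ => x + k) ''
          ⋃ n : ℕ, Set.Ioo ((n : ℝ) + n / (n + 1)) ((n : ℝ) + (n + 1) / (n + 2)))) ∧
    (⋃ m : ℤ, (fun x : ℝ => x + m) ''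
        closure (⋃ n : ℕ, Set.Ioo ((n : ℝ) + n / (n + 1)) ((n : ℝ) + (n + 1) / (n + 2)))) =
      Set.univ ∧
    ¬ IsCompact
      (closure (⋃ n : ℕ, Set.Ioo ((n : ℝ) + n / (n + 1)) ((n : ℝ) + (n + 1) / (n + 2)))) := by
  refine ⟨isOpen_iUnion fun n => isOpen_Ioo, ?_, ?_, ?_⟩
  · intro m k hmk
    rw [Set.disjoint_left]
    rintro _ ⟨x, hx, rfl⟩ ⟨y, hy, hxy⟩
    obtain ⟨n, hx⟩ := Set.mem_iUnion.mp hx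
    obtain ⟨l, hy⟩ := Set.mem_iUnion.mp hy
    obtain ⟨x1, x2, x3, x4⟩ := aux_mem hx
    obtain ⟨y1, y2, y3, y4⟩ := aux_mem hy
    simp only at hxy
    have e1 : (n : ℤ) + m < l + k + 1 := by
      have : (n : ℝ) + m < l + k + 1 := by linarith
      exact_mod_cast this
    have e2 : (l : ℤ) + k < n + m + 1 := by
      have : (l : ℝ) + k < n + m + 1 := by linarith
      exact_mod_cast this
    have e : (n : ℤ) + m = l + k := by omega
    have e' : (n : ℝ) + m = l + k := by exact_mod_cast e
    have huv : x - n = y - l := by linarith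
    rw [← huv] at y3 y4
    have b1 := aux_le (by linarith) x4 y3
    have b2 := aux_le (by linarith) y4 x3
    exact hmk (by omega)
  · refine Set.eq_univ_of_forall fun x => ?_
    have f0 := Int.fract_nonneg x
    have f1 := Int.fract_lt_one x
    have fx := Int.floor_add_fract x
    set f := Int.fract x
    have hpos : 0 < 1 - f := by linarith
    have hge : 1 ≤ 1 / (1 - f) := by rw [le_div_iff₀ hpos]; linarith
    have hN : 1 ≤ ⌊1 / (1 - f)⌋₊ := Nat.le_floor (by exact_mod_cast hge)
    obtain ⟨n, hn⟩ := Nat.exists_eq_add_of_le' hN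
    have g1 := Nat.floor_le (by linarith : 0 ≤ 1 / (1 - f))
    have g2 := Nat.lt_floor_add_one (1 / (1 - f))
    rw [hn] at g1 g2
    push_cast at g1 g2
    rw [le_div_iff₀ hpos] at g1
    rw [div_lt_iff₀ hpos] at g2
    refine Set.mem_iUnion.mpr ⟨⌊x⌋ - n, f + n, ?_, ?_⟩
    · refine closure_mono (Set.subset_iUnion _ n) ?_
      rw [closure_Ioo (aux_lt n).ne]
      have c1 : (n : ℝ) / (n + 1) ≤ f := by
        rw [div_le_iff₀ (by positivity)]; linarith
      have c2 : f ≤ ((n : ℝ) + 1) / (n + 2) := by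
        rw [le_div_iff₀ (by positivity)]; linarith
      constructor <;> linarith
    · push_cast
      linarith
  · intro hc
    obtain ⟨B, hB⟩ := hc.bddAbove
    obtain ⟨n, hn⟩ := exists_nat_gt B
    obtain ⟨z, hz⟩ := exists_between (aux_lt n)
    have := hB (subset_closure (Set.mem_iUnion.mpr ⟨n, hz⟩))
    have := (aux_mem hz).1
    linarith
end
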